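/- Let q be a prime power, N ≥ 2, and 2 ≤ K ≤ N. A probability distribution P on 𝔽_q^N \ {0} maximizes the probability that K i.i.d. vectors drawn from P are linearly independent if and only if its projective pushforward is uniform, i.e., Σ_{v ∈ L, v ≠ 0} P(v) = (q−1)/(q^N−1) for every one-dimensional subspace L of 𝔽_q^N. -/

import Mathlib

open Finset Classical
open scoped LinearAlgebra.Projectivization

/-- The probability that `K` i.i.d. vectors drawn from a distribution `P` on the
nonzero vectors of `𝔽_q^N` are linearly independent. -/
noncomputable def vecIndepProb (F : Type*) [Field F] [Fintype F] (N K : ℕ)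
    (P : {v : Fin N → F // v ≠ 0} → ℝ) : ℝ :=
  ∑ x : Fin K → {v : Fin N → F // v ≠ 0},
    if LinearIndependent F (fun i => (x i : Fin N → F)) then ∏ i, P (x i) else 0

section RealInequalities

theorem mul_sub_pow_le_tangent {m t x : ℝ} (ht : 0 ≤ t) (hx : x ≤ m) (k : ℕ)
    (hk : (k + 1) * t ≤ m) :
    x * (m - x) ^ (k + 1) ≤
      (m - t) ^ k * (m * x - (k + 2) * t * x + (k + 1) * t ^ 2) := by
  induction k with
  | zero => simp; nlinarith [sq_nonneg (x - t)]
  | succ k ih =>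
    push_cast at hk ⊢
    have hkt : 0 ≤ k * t := by positivity
    have hmt : 0 ≤ (m - t) ^ k := pow_nonneg (by linarith) k
    have h₁ := mul_le_mul_of_nonneg_right (ih (by linarith)) (sub_nonneg.2 hx)
    have h₂ : 0 ≤ (m - t) ^ k * ((x - t) ^ 2 * (m - (k + 2) * t)) :=
      mul_nonneg hmt (mul_nonneg (sq_nonneg _) (by linarith))
    rw [pow_succ (m - x), pow_succ (m - t)]
    linear_combination h₁ + h₂

theorem mul_sub_pow_lt_tangent {m t x : ℝ} (ht : 0 ≤ t) (hm : t < m) (hx : x ≤ m) (hxt : x ≠ t)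
    (k : ℕ) (hk : (k + 1) * t < m) :
    x * (m - x) ^ (k + 1) <
      (m - t) ^ k * (m * x - (k + 2) * t * x + (k + 1) * t ^ 2) := by
  have hsq : 0 < (x - t) ^ 2 := sq_pos_of_ne_zero (sub_ne_zero.2 hxt)
  cases k with
  | zero => simp; nlinarith
  | succ k =>
    push_cast at hk ⊢
    have hkt : 0 ≤ k * t := by positivity
    have h₁ := mul_le_mul_of_nonneg_right
      (mul_sub_pow_le_tangent ht hx k (by linarith)) (sub_nonneg.2 hx)
    have h₂ : 0 < (m - t) ^ k * ((x - t) ^ 2 * (m - (k + 2) * t)) :=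
      mul_pos (pow_pos (by linarith) k) (mul_pos hsq (by linarith))
    rw [pow_succ (m - x), pow_succ (m - t)]
    linear_combination h₁ + h₂

theorem sum_tangent {α : Type*} [Fintype α] (x : α → ℝ) {m t : ℝ} (hm : ∑ a, x a = m)
    (ht : Fintype.card α * t = m) (k : ℕ) :
    ∑ a, (m - t) ^ k * (m * x a - (k + 2) * t * x a + (k + 1) * t ^ 2) =
      m * (m - t) ^ (k + 1) := by
  rw [← Finset.mul_sum, Finset.sum_add_distrib, Finset.sum_sub_distrib, ← Finset.mul_sum,
    ← Finset.mul_sum, hm, Finset.sum_const, Finset.card_univ, nsmul_eq_mul]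
  linear_combination (m - t) ^ k * (k + 1) * t * ht

theorem sum_mul_sub_pow_le {α : Type*} [Fintype α] {x : α → ℝ} (hx : ∀ a, 0 ≤ x a) {m t : ℝ}
    (hm : ∑ a, x a = m) (ht : Fintype.card α * t = m) (k : ℕ) (hk : k < Fintype.card α) :
    ∑ a, x a * (m - x a) ^ k ≤ m * (m - t) ^ k := by
  have hm0 : 0 ≤ m := hm ▸ Finset.sum_nonneg fun a _ => hx a
  have hc : (0 : ℝ) < Fintype.card α := by exact_mod_cast (by omega : 0 < Fintype.card α)
  have ht0 : 0 ≤ t := by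
    by_contra! h
    nlinarith
  cases k with
  | zero => simp [hm]
  | succ k =>
    rw [← sum_tangent x hm ht]
    refine Finset.sum_le_sum fun a _ => mul_sub_pow_le_tangent ht0 ?_ k ?_
    · exact hm ▸ Finset.single_le_sum (fun b _ => hx b) (Finset.mem_univ a)
    · rw [← ht]
      gcongr
      exact_mod_cast hk.le

theorem sum_mul_sub_pow_lt {α : Type*} [Fintype α] {x : α → ℝ} (hx : ∀ a, 0 ≤ x a) {m t : ℝ}
    (hm : ∑ a, x a = m) (hm0 : 0 < m) (ht : Fintype.card α * t = m) {k : ℕ} (hk0 : k ≠ 0)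
    (hk : k < Fintype.card α) {a : α} (ha : x a ≠ t) :
    ∑ a, x a * (m - x a) ^ k < m * (m - t) ^ k := by
  have hc : (0 : ℝ) < Fintype.card α := by exact_mod_cast (by omega : 0 < Fintype.card α)
  have ht0 : 0 < t := by
    by_contra! h
    nlinarith
  obtain ⟨k, rfl⟩ := Nat.exists_eq_succ_of_ne_zero hk0
  have hxm (b : α) : x b ≤ m :=
    hm ▸ Finset.single_le_sum (fun b _ => hx b) (Finset.mem_univ b)
  have hkt : ((k : ℝ) + 1) * t < m := by
    rw [← ht]
    gcongr
    exact_mod_cast hk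
  rw [← sum_tangent x hm ht]
  refine Finset.sum_lt_sum (fun b _ => mul_sub_pow_le_tangent ht0.le (hxm b) k hkt.le)
    ⟨a, Finset.mem_univ a, mul_sub_pow_lt_tangent ht0.le ?_ (hxm a) ha k hkt⟩
  nlinarith [(by positivity : (0 : ℝ) ≤ k * t)]

end RealInequalities

section Constant

/-- The probability that `k` independent uniform nonzero vectors of an `n`-dimensional space over a
field with `q` elements are linearly independent. -/
noncomputable def uniformIndepProb (q : ℝ) (n k : ℕ) : ℝ :=
  ∏ i ∈ Finset.range k, (q ^ n - q ^ i) / (q ^ n - 1)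

theorem uniformIndepProb_pos {q : ℝ} (hq : 1 < q) {n k : ℕ} (hkn : k ≤ n) :
    0 < uniformIndepProb q n k := by
  refine Finset.prod_pos fun i hi => ?_
  have hi := Finset.mem_range.1 hi
  exact div_pos (sub_pos.2 (pow_lt_pow_right₀ hq (by omega)))
    (sub_pos.2 (one_lt_pow₀ hq (by omega)))

theorem uniformIndepProb_succ_succ {q : ℝ} (hq : 1 < q) {n k : ℕ} (hkn : k ≤ n) :
    uniformIndepProb q (n + 1) (k + 1) =
      uniformIndepProb q n k * ((q ^ (n + 1) - q) / (q ^ (n + 1) - 1)) ^ k := by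
  have h₁ : q ^ (n + 1) - 1 ≠ 0 := (sub_pos.2 (one_lt_pow₀ hq (by omega))).ne'
  rw [uniformIndepProb, Finset.prod_range_succ', pow_zero, div_self h₁, mul_one]
  conv_rhs => rw [← Finset.card_range k, ← Finset.prod_const, Finset.card_range]
  rw [uniformIndepProb, ← Finset.prod_mul_distrib]
  refine Finset.prod_congr rfl fun i hi => ?_
  have hi := Finset.mem_range.1 hi
  have h₂ : q ^ n - 1 ≠ 0 := (sub_pos.2 (one_lt_pow₀ hq (by omega))).ne'
  field_simp
  ring

end Constant

section IndependentTuples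

variable {F : Type*} [Field F]

theorem linearIndependent_fin_succ_iff_quotient {V : Type*} [AddCommGroup V] [Module F V] {k : ℕ}
    (v : Fin (k + 1) → V) :
    LinearIndependent F v ↔
      v 0 ≠ 0 ∧ LinearIndependent F fun i : Fin k => (F ∙ v 0).mkQ (v i.succ) := by
  have hdisj : Disjoint ({0} : Set (Fin (k + 1))) (Set.range Fin.succ) := by
    simp [Set.disjoint_singleton_left]
  have huniv : ({0} : Set (Fin (k + 1))) ∪ Set.range Fin.succ = Set.univ := by
    rw [Fin.range_succ]; exact Set.union_compl_self _
  rw [← linearIndepOn_univ_iff, ← huniv, linearIndepOn_union_iff_quotient hdisj,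
    linearIndepOn_singleton_iff, Set.image_singleton,
    linearIndepOn_range_iff (Fin.succ_injective k)]
  rfl

variable {ι : Type*} [Fintype ι]

/-- The total weight of the `k`-tuples of indices whose images under `u` are linearly
independent, for the product of the weight `w`. -/
noncomputable def indepWeight (F : Type*) [Field F] {V : Type*} [AddCommGroup V] [Module F V]
    (k : ℕ) (u : ι → V) (w : ι → ℝ) : ℝ :=
  ∑ x : Fin k → ι, if LinearIndependent F (fun i => u (x i)) then ∏ i, w (x i) else 0

/-- The weight of the indices that `u` sends into `s`. -/
noncomputable def massOn {V : Type*} (u : ι → V) (w : ι → ℝ) (s : Set V) : ℝ :=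
  ∑ i, if u i ∈ s then w i else 0

theorem massOn_nonneg {V : Type*} (u : ι → V) {w : ι → ℝ} (hw : ∀ i, 0 ≤ w i) (s : Set V) :
    0 ≤ massOn u w s :=
  Finset.sum_nonneg fun i _ => by split_ifs <;> simp [hw]

variable {V : Type*} [AddCommGroup V] [Module F V]

theorem mk_eq_iff_mem_submodule {v : V} (hv : v ≠ 0) (L : ℙ F V) :
    Projectivization.mk F v hv = L ↔ v ∈ L.submodule := by
  induction L using Projectivization.ind with
  | h x hx =>
    rw [Projectivization.submodule_mk, Projectivization.mk_eq_mk_iff', Submodule.mem_span_singleton]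

theorem sum_massOn_points_mul [Fintype (ℙ F V)] (u : ι → V) (w : ι → ℝ) (g : Submodule F V → ℝ) :
    ∑ L : ℙ F V, massOn u w (L.submodule \ {0}) * g L.submodule =
      ∑ i, if u i ≠ 0 then w i * g (F ∙ u i) else 0 := by
  simp_rw [massOn, Finset.sum_mul]
  rw [Finset.sum_comm]
  refine Finset.sum_congr rfl fun i _ => ?_
  by_cases hi : u i = 0
  · simp [hi]
  · simp only [Set.mem_sdiff, SetLike.mem_coe, Set.mem_singleton_iff, hi, not_false_eq_true,
      and_true, ne_eq, if_true, ← mk_eq_iff_mem_submodule hi]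
    simp [ite_mul, Projectivization.submodule_mk]

theorem sum_massOn_points [Fintype (ℙ F V)] (u : ι → V) (w : ι → ℝ) :
    ∑ L : ℙ F V, massOn u w (L.submodule \ {0}) = massOn u w {0}ᶜ := by
  simpa [massOn] using sum_massOn_points_mul (F := F) u w 1

theorem massOn_mkQ (u : ι → V) (w : ι → ℝ) (W : Submodule F V) :
    massOn (fun i => W.mkQ (u i)) w {0}ᶜ = massOn u w {0}ᶜ - massOn u w (W \ {0}) := by
  rw [massOn, massOn, massOn, ← Finset.sum_sub_distrib]
  refine Finset.sum_congr rfl fun i _ => ?_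
  by_cases hi : u i = 0 <;> by_cases hW : u i ∈ W <;> simp [hi, hW]

theorem indepWeight_succ [Fintype (ℙ F V)] (k : ℕ) (u : ι → V) (w : ι → ℝ) :
    indepWeight F (k + 1) u w =
      ∑ L : ℙ F V, massOn u w (L.submodule \ {0}) *
        indepWeight F k (fun i => L.submodule.mkQ (u i)) w := by
  rw [sum_massOn_points_mul u w fun W => indepWeight F k (fun i => W.mkQ (u i)) w, indepWeight,
    ← (Fin.consEquiv fun _ => ι).sum_comp, Fintype.sum_prod_type]
  refine Finset.sum_congr rfl fun i _ => ?_
  simp only [Fin.consEquiv_apply, linearIndependent_fin_succ_iff_quotient, Fin.cons_zero,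
    Fin.cons_succ, Fin.prod_univ_succ]
  by_cases hi : u i = 0
  · simp [hi]
  · simp only [ne_eq, hi, not_false_eq_true, true_and, if_true, indepWeight, Finset.mul_sum,
      mul_ite, mul_zero]
    rfl

theorem independent_mk_iff {κ : Type*} (v : κ → V) (hv : ∀ i, v i ≠ 0) :
    Projectivization.Independent (fun i => Projectivization.mk F (v i) (hv i)) ↔
      LinearIndependent F v := by
  refine ⟨fun h => ?_, fun h => .mk v hv h⟩
  rw [Projectivization.independent_iff] at h
  choose a ha using fun i => Projectivization.exists_smul_eq_mk_rep F (v i) (hv i)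
  rw [← LinearIndependent.units_smul_iff (w := a)]
  convert h using 1
  exact funext ha

theorem indepWeight_eq_sum_points [Fintype (ℙ F V)] (k : ℕ) (u : ι → V) (w : ι → ℝ) :
    indepWeight F k u w =
      ∑ ℓ : Fin k → ℙ F V, if Projectivization.Independent ℓ
        then ∏ i, massOn u w ((ℓ i).submodule \ {0}) else 0 := by
  have hterm (ℓ : Fin k → ℙ F V) :
      (if Projectivization.Independent ℓ then ∏ i, massOn u w ((ℓ i).submodule \ {0}) else 0) =
        ∑ x : Fin k → ι, if Projectivization.Independent ℓ then
          if ∀ i, u (x i) ∈ ((ℓ i).submodule \ {0} : Set V) then ∏ i, w (x i) else 0 else 0 := by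
    split_ifs with hℓ
    · simp_rw [massOn, Finset.prod_univ_sum, Fintype.piFinset_univ]
      refine Finset.sum_congr rfl fun x _ => ?_
      split_ifs with h
      · exact Finset.prod_congr rfl fun i _ => if_pos (h i)
      · obtain ⟨i, hi⟩ := not_forall.1 h
        exact Finset.prod_eq_zero (Finset.mem_univ i) (if_neg hi)
    · simp
  simp_rw [hterm, indepWeight]
  rw [Finset.sum_comm]
  refine Finset.sum_congr rfl fun x _ => ?_
  by_cases hx : ∀ i, u (x i) ≠ 0
  · simp only [Set.mem_sdiff, SetLike.mem_coe, Set.mem_singleton_iff, hx, not_false_eq_true,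
      and_true, ← mk_eq_iff_mem_submodule (hx _), ← funext_iff, ← ite_and]
    rw [← independent_mk_iff _ hx]
    rw [Finset.sum_eq_single fun i => Projectivization.mk F (u (x i)) (hx i)]
    · simp
    · rintro ℓ - hℓ
      rw [if_neg fun h => hℓ h.2.symm]
    · simp
  · push Not at hx
    obtain ⟨i, hi⟩ := hx
    rw [if_neg fun h => h.ne_zero i hi]
    refine (Finset.sum_eq_zero fun ℓ _ => ?_).symm
    have hℓ : ¬ ∀ j, u (x j) ∈ ((ℓ j).submodule \ {0} : Set V) := fun h => (h i).2 hi
    simp only [hℓ, if_false, ite_self]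

/-- The weight of independent tuples only depends on the weights of the projective points. -/
theorem indepWeight_congr [Fintype (ℙ F V)] (k : ℕ) (u : ι → V) {w w' : ι → ℝ}
    (h : ∀ L : ℙ F V, massOn u w (L.submodule \ {0}) = massOn u w' (L.submodule \ {0})) :
    indepWeight F k u w = indepWeight F k u w' := by
  simp_rw [indepWeight_eq_sum_points, h]

theorem finrank_quotient_point [Module.Finite F V] {n : ℕ} (hn : Module.finrank F V = n + 1)
    (L : ℙ F V) :
    Module.finrank F (V ⧸ L.submodule) = n := by
  have := L.submodule.finrank_quotient_add_finrank
  rw [L.finrank_submodule, hn] at this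
  omega

end IndependentTuples

section FiniteField

variable {F : Type*} [Field F] [Fintype F] {ι : Type*} [Fintype ι]

theorem one_lt_card_cast : (1 : ℝ) < Fintype.card F := by
  exact_mod_cast Fintype.one_lt_card

theorem card_points_mul {V : Type*} [AddCommGroup V] [Module F V] [Fintype (ℙ F V)]
    {n : ℕ} (hn : Module.finrank F V = n) :
    (Fintype.card (ℙ F V) : ℝ) * ((Fintype.card F : ℝ) - 1) = (Fintype.card F : ℝ) ^ n - 1 := by
  have h := Projectivization.card_of_finrank F V hn
  rw [Nat.card_eq_fintype_card, Nat.card_eq_fintype_card] at h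
  rw [h]
  push_cast
  exact geom_sum_mul _ _

theorem le_card_points {V : Type*} [AddCommGroup V] [Module F V] [Fintype (ℙ F V)]
    {n : ℕ} (hn : Module.finrank F V = n) : n ≤ Fintype.card (ℙ F V) := by
  have h := Projectivization.card_of_finrank F V hn
  rw [Nat.card_eq_fintype_card, Nat.card_eq_fintype_card] at h
  rw [h]
  simpa using Finset.card_nsmul_le_sum (Finset.range n) (fun i => Fintype.card F ^ i) 1
    fun i _ => Nat.one_le_pow _ _ Fintype.card_pos

theorem uniformIndepProb_mul_pow {q : ℝ} (hq : 1 < q) {n k : ℕ} (hkn : k ≤ n) (m : ℝ) :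
    uniformIndepProb q n k * (m * (m - m * ((q - 1) / (q ^ (n + 1) - 1))) ^ k) =
      uniformIndepProb q (n + 1) (k + 1) * m ^ (k + 1) := by
  have h : q ^ (n + 1) - 1 ≠ 0 := (sub_pos.2 (one_lt_pow₀ hq (by omega))).ne'
  have hm : m - m * ((q - 1) / (q ^ (n + 1) - 1)) =
      m * ((q ^ (n + 1) - q) / (q ^ (n + 1) - 1)) := by
    field_simp
    ring
  rw [hm, uniformIndepProb_succ_succ hq hkn, mul_pow, pow_succ m]
  ring

theorem card_points_mul_mass {V : Type*} [AddCommGroup V] [Module F V] [Fintype (ℙ F V)]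
    {n : ℕ} (hn : Module.finrank F V = n + 1) (m : ℝ) :
    Fintype.card (ℙ F V) *
      (m * (((Fintype.card F : ℝ) - 1) / ((Fintype.card F : ℝ) ^ (n + 1) - 1))) = m := by
  have h : (Fintype.card F : ℝ) ^ (n + 1) - 1 ≠ 0 :=
    (sub_pos.2 (one_lt_pow₀ one_lt_card_cast (by omega))).ne'
  rw [mul_left_comm, ← mul_div_assoc, card_points_mul hn, div_self h, mul_one]

theorem indepWeight_le {V : Type*} [AddCommGroup V] [Module F V] [Module.Finite F V]
    {k n : ℕ} (hn : Module.finrank F V = n) (hkn : k ≤ n) (u : ι → V)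
    {w : ι → ℝ} (hw : ∀ i, 0 ≤ w i) :
    indepWeight F k u w ≤
      uniformIndepProb (Fintype.card F) n k * massOn u w {0}ᶜ ^ k := by
  induction k generalizing V n with
  | zero => simp [indepWeight, uniformIndepProb]
  | succ k ih =>
    obtain ⟨n, rfl⟩ : ∃ m, n = m + 1 := ⟨n - 1, by omega⟩
    have hkn' : k ≤ n := by omega
    have := Module.finite_of_finite F (M := V)
    let := Fintype.ofFinite (ℙ F V)
    calc indepWeight F (k + 1) u w
        = ∑ L : ℙ F V, massOn u w (L.submodule \ {0}) *
            indepWeight F k (fun i => L.submodule.mkQ (u i)) w := indepWeight_succ k u w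
      _ ≤ ∑ L : ℙ F V, massOn u w (L.submodule \ {0}) * (uniformIndepProb (Fintype.card F) n k *
            (massOn u w {0}ᶜ - massOn u w (L.submodule \ {0})) ^ k) := by
          refine Finset.sum_le_sum fun L _ => mul_le_mul_of_nonneg_left ?_ (massOn_nonneg u hw _)
          rw [← massOn_mkQ]
          exact ih (finrank_quotient_point hn L) hkn' _
      _ = uniformIndepProb (Fintype.card F) n k * ∑ L : ℙ F V, massOn u w (L.submodule \ {0}) *
            (massOn u w {0}ᶜ - massOn u w (L.submodule \ {0})) ^ k := by
          simp_rw [Finset.mul_sum, mul_left_comm]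
      _ ≤ _ := by
          rw [← uniformIndepProb_mul_pow one_lt_card_cast hkn']
          exact mul_le_mul_of_nonneg_left
            (sum_mul_sub_pow_le (fun _ => massOn_nonneg u hw _) (sum_massOn_points u w)
              (card_points_mul_mass hn _) k (hkn.trans (le_card_points hn)))
            (uniformIndepProb_pos one_lt_card_cast hkn').le

theorem indepWeight_lt {V : Type*} [AddCommGroup V] [Module F V] [Module.Finite F V]
    {k n : ℕ} (hn : Module.finrank F V = n) (hk : 2 ≤ k) (hkn : k ≤ n) (u : ι → V)
    {w : ι → ℝ} (hw : ∀ i, 0 ≤ w i) (hm : 0 < massOn u w {0}ᶜ) {L : ℙ F V}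
    (hL : massOn u w (L.submodule \ {0}) ≠
      massOn u w {0}ᶜ * (((Fintype.card F : ℝ) - 1) / ((Fintype.card F : ℝ) ^ n - 1))) :
    indepWeight F k u w <
      uniformIndepProb (Fintype.card F) n k * massOn u w {0}ᶜ ^ k := by
  obtain ⟨k, rfl⟩ : ∃ m, k = m + 1 := ⟨k - 1, by omega⟩
  obtain ⟨n, rfl⟩ : ∃ m, n = m + 1 := ⟨n - 1, by omega⟩
  have hkn' : k ≤ n := by omega
  have := Module.finite_of_finite F (M := V)
  let := Fintype.ofFinite (ℙ F V)
  calc indepWeight F (k + 1) u w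
      = ∑ L : ℙ F V, massOn u w (L.submodule \ {0}) *
          indepWeight F k (fun i => L.submodule.mkQ (u i)) w := indepWeight_succ k u w
    _ ≤ ∑ L : ℙ F V, massOn u w (L.submodule \ {0}) * (uniformIndepProb (Fintype.card F) n k *
          (massOn u w {0}ᶜ - massOn u w (L.submodule \ {0})) ^ k) := by
        refine Finset.sum_le_sum fun L _ => mul_le_mul_of_nonneg_left ?_ (massOn_nonneg u hw _)
        rw [← massOn_mkQ]
        exact indepWeight_le (finrank_quotient_point hn L) hkn' _ hw
    _ = uniformIndepProb (Fintype.card F) n k * ∑ L : ℙ F V, massOn u w (L.submodule \ {0}) *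
          (massOn u w {0}ᶜ - massOn u w (L.submodule \ {0})) ^ k := by
        simp_rw [Finset.mul_sum, mul_left_comm]
    _ < _ := by
        rw [← uniformIndepProb_mul_pow one_lt_card_cast hkn']
        exact mul_lt_mul_of_pos_left
          (sum_mul_sub_pow_lt (fun _ => massOn_nonneg u hw _) (sum_massOn_points u w) hm
            (card_points_mul_mass hn _) (by omega) (hkn.trans (le_card_points hn)) hL)
          (uniformIndepProb_pos one_lt_card_cast hkn')

theorem card_nonzero {V : Type*} [Zero V] [Fintype V] [Fintype {v : V // v ≠ 0}] :
    Fintype.card {v : V // v ≠ 0} = Fintype.card V - 1 := by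
  simp [Fintype.card_subtype_compl]

theorem indepWeight_const {V : Type*} [AddCommGroup V] [Module F V] [Fintype V]
    [Fintype {v : V // v ≠ 0}] {k n : ℕ} (hn : Module.finrank F V = n) (hkn : k ≤ n) :
    indepWeight F k (Subtype.val : {v : V // v ≠ 0} → V)
      (fun _ => 1 / ((Fintype.card F : ℝ) ^ n - 1)) = uniformIndepProb (Fintype.card F) n k := by
  let e : {x : Fin k → {v : V // v ≠ 0} // LinearIndependent F fun i => (x i : V)} ≃
      {s : Fin k → V // LinearIndependent F s} :=
    { toFun := fun x => ⟨fun i => x.1 i, x.2⟩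
      invFun := fun s => ⟨fun i => ⟨s.1 i, s.2.ne_zero i⟩, s.2⟩
      left_inv := fun _ => rfl
      right_inv := fun _ => rfl }
  have hcard := Nat.card_congr e
  rw [card_linearIndependent (hn ▸ hkn), Nat.card_eq_fintype_card,
    Fintype.card_subtype, hn] at hcard
  rw [indepWeight, ← Finset.sum_filter, Finset.sum_const]
  simp only [Finset.prod_const, Finset.card_univ, Fintype.card_fin, nsmul_eq_mul]
  rw [hcard, uniformIndepProb, Finset.prod_div_distrib, Finset.prod_const, Finset.card_range,
    ← Fin.prod_univ_eq_prod_range (fun i => (Fintype.card F : ℝ) ^ n - (Fintype.card F : ℝ) ^ i),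
    one_div_pow, mul_one_div]
  congr 1
  push_cast
  refine Finset.prod_congr rfl fun i _ => ?_
  rw [Nat.cast_sub (Nat.pow_le_pow_right Fintype.card_pos (by omega))]
  push_cast
  rfl

end FiniteField

/-- **Vector-level optimality criterion.** For `2 ≤ K ≤ N`, a distribution `P` on
`𝔽_q^N \ {0}` maximizes the probability that `K` i.i.d. vectors drawn from `P` are
linearly independent if and only if its projective pushforward is uniform,
i.e. `∑_{v ∈ L, v ≠ 0} P(v) = (q−1)/(q^N−1)` for every projective point `L`. -/
theorem vecIndepProb_max_iff_pushforward_uniform (F : Type*) [Field F] [Fintype F]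
    (q : ℕ) (hq : q = Fintype.card F) (N K : ℕ) (hN : 2 ≤ N) (hK : 2 ≤ K) (hKN : K ≤ N)
    (P : {v : Fin N → F // v ≠ 0} → ℝ) (hP0 : ∀ v, 0 ≤ P v) (hP1 : ∑ v, P v = 1) :
    (∀ P' : {v : Fin N → F // v ≠ 0} → ℝ, (∀ v, 0 ≤ P' v) → (∑ v, P' v = 1) →
        vecIndepProb F N K P' ≤ vecIndepProb F N K P) ↔
    (∀ L : ℙ F (Fin N → F),
        (∑ v : {v : Fin N → F // v ≠ 0},
          if Projectivization.mk F v.1 v.2 = L then P v else 0)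
          = ((q : ℝ) - 1) / ((q : ℝ) ^ N - 1)) := by
  subst hq
  have hprob (P : {v : Fin N → F // v ≠ 0} → ℝ) :
      vecIndepProb F N K P = indepWeight F K Subtype.val P := rfl
  have hn : Module.finrank F (Fin N → F) = N := Module.finrank_fin_fun F
  have hmass (P : {v : Fin N → F // v ≠ 0} → ℝ) : massOn Subtype.val P {0}ᶜ = ∑ v, P v :=
    Finset.sum_congr rfl fun v _ => if_pos v.2
  have hpoint (P : {v : Fin N → F // v ≠ 0} → ℝ) (L : ℙ F (Fin N → F)) :
      massOn Subtype.val P (L.submodule \ {0}) =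
        ∑ v, if Projectivization.mk F v.1 v.2 = L then P v else 0 := by
    refine Finset.sum_congr rfl fun v _ => ?_
    simp [mk_eq_iff_mem_submodule, v.2]
  have hbound (P : {v : Fin N → F // v ≠ 0} → ℝ) (hP0 : ∀ v, 0 ≤ P v) (hP1 : ∑ v, P v = 1) :
      vecIndepProb F N K P ≤ uniformIndepProb (Fintype.card F) N K := by
    simpa [hmass, hP1, hprob] using indepWeight_le hn hKN Subtype.val hP0
  have hstrict (P : {v : Fin N → F // v ≠ 0} → ℝ) (hP0 : ∀ v, 0 ≤ P v) (hP1 : ∑ v, P v = 1)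
      (hP : uniformIndepProb (Fintype.card F) N K ≤ vecIndepProb F N K P)
      (L : ℙ F (Fin N → F)) : massOn Subtype.val P (L.submodule \ {0}) =
        ((Fintype.card F : ℝ) - 1) / ((Fintype.card F : ℝ) ^ N - 1) := by
    by_contra hL
    refine hP.not_gt ?_
    have h := indepWeight_lt hn hK hKN Subtype.val hP0 (by rw [hmass, hP1]; exact one_pos) (L := L)
      (by rwa [hmass, hP1, one_mul])
    rwa [hmass, hP1, one_pow, mul_one] at h
  have hq : (0 : ℝ) < (Fintype.card F : ℝ) ^ N - 1 :=
    sub_pos.2 (one_lt_pow₀ one_lt_card_cast (by omega))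
  let U : {v : Fin N → F // v ≠ 0} → ℝ := fun _ => 1 / ((Fintype.card F : ℝ) ^ N - 1)
  have hU0 (v) : 0 ≤ U v := (one_div_pos.2 hq).le
  have hU1 : ∑ v, U v = 1 := by
    have hcard : Fintype.card {v : Fin N → F // v ≠ 0} = Fintype.card F ^ N - 1 := by
      rw [card_nonzero, Fintype.card_fun, Fintype.card_fin]
    rw [Finset.sum_const, Finset.card_univ, hcard, nsmul_eq_mul,
      Nat.cast_sub (Nat.one_le_pow _ _ Fintype.card_pos)]
    push_cast
    exact mul_one_div_cancel hq.ne'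
  have hU : vecIndepProb F N K U = uniformIndepProb (Fintype.card F) N K :=
    indepWeight_const hn hKN
  simp_rw [← hpoint]
  constructor
  · intro hmax
    exact hstrict P hP0 hP1 (hU ▸ hmax U hU0 hU1)
  · intro hunif P' hP'0 hP'1
    let := Fintype.ofFinite (ℙ F (Fin N → F))
    have hPU : vecIndepProb F N K P = vecIndepProb F N K U :=
      indepWeight_congr (F := F) K Subtype.val fun L =>
        (hunif L).trans (hstrict U hU0 hU1 hU.ge L).symm
    rw [hPU, hU]
    exact hbound P' hP'0 hP'1
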